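/- arXiv:1105.5067 — 3 statements merged into one kernel-verified Lean document; each statement's English description precedes it below -/
import Mathlib

section
/- Gauss infinitesimal rigidity of strictly convex surfaces: let φ : 𝕊² → ℝ³ be a smooth embedding, ν a unit normal field for φ, and assume φ has everywhere positive Gauss curvature with respect to ν. Then every isogauss infinitesimal deformation η of φ with respect to ν is trivial: there exists a vector a ∈ ℝ³ such that η x = a for all x ∈ 𝕊². -/
noncomputable section

open scoped Manifold RealInnerProductSpace
open Metric Module

local notation "ℝ³" => EuclideanSpace ℝ (Fin 3)

instance : Fact (finrank ℝ ℝ³ = 2 + 1) := ⟨by simp⟩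

local notation "𝕊²" => sphere (0 : ℝ³) 1

/-- The cross product on `ℝ³ = EuclideanSpace ℝ (Fin 3)`. -/
def cross (a b : ℝ³) : ℝ³ :=
  (EuclideanSpace.equiv (Fin 3) ℝ).symm
    (crossProduct (EuclideanSpace.equiv (Fin 3) ℝ a) (EuclideanSpace.equiv (Fin 3) ℝ b))

/-- `f : 𝕊² → ℝ³` is smooth (`C^∞`). -/
def Smooth3 (f : 𝕊² → ℝ³) : Prop := ContMDiff (𝓡 2) 𝓘(ℝ, ℝ³) (⊤ : ℕ∞) f

/-- The manifold derivative of `f : 𝕊² → ℝ³` at `x ∈ 𝕊²`. -/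
def mfd (f : 𝕊² → ℝ³) (x : 𝕊²) : TangentSpace (𝓡 2) x →L[ℝ] ℝ³ :=
  mfderiv (𝓡 2) 𝓘(ℝ, ℝ³) f x

/-- `ν` is a unit normal field for `φ`. -/
def IsUnitNormalField (φ ν : 𝕊² → ℝ³) : Prop :=
  Smooth3 ν ∧ (∀ x, ‖ν x‖ = 1) ∧
    ∀ (x : 𝕊²) (X : TangentSpace (𝓡 2) x), ⟪ν x, mfd φ x X⟫ = 0

/-- `φ` has everywhere positive Gauss curvature with respect to `ν`. -/
def PosGaussCurvature (φ ν : 𝕊² → ℝ³) : Prop :=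
  ∀ (x : 𝕊²) (X Y : TangentSpace (𝓡 2) x), LinearIndependent ℝ ![X, Y] →
    0 < ⟪cross (mfd ν x X) (mfd ν x Y), cross (mfd φ x X) (mfd φ x Y)⟫

/-- `η` is an isogauss infinitesimal deformation of `φ` with respect to `ν`. -/
def IsIsogaussDeformation (φ ν η : 𝕊² → ℝ³) : Prop :=
  Smooth3 η ∧
    (∀ (x : 𝕊²) (X : TangentSpace (𝓡 2) x), ⟪mfd η x X, ν x⟫ = 0) ∧
    ∀ (x : 𝕊²) (X Y : TangentSpace (𝓡 2) x),
      cross (mfd η x X) (mfd φ x Y) + cross (mfd φ x X) (mfd η x Y) = 0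

/-- `ξ` is an isometric infinitesimal deformation of `φ`. -/
def IsIsometricDeformation (φ ξ : 𝕊² → ℝ³) : Prop :=
  Smooth3 ξ ∧
    ∀ (x : 𝕊²) (X Y : TangentSpace (𝓡 2) x),
      ⟪mfd ξ x X, mfd φ x Y⟫ + ⟪mfd φ x X, mfd ξ x Y⟫ = 0

/-- `η` is the rotation vector field of the isometric infinitesimal deformation `ξ` of `φ`. -/
def IsRotationField (φ ξ η : 𝕊² → ℝ³) : Prop :=
  Smooth3 η ∧
    ∀ (x : 𝕊²) (X : TangentSpace (𝓡 2) x), mfd ξ x X = cross (η x) (mfd φ x X)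

/-! ### Local homeomorphisms of the sphere are injective -/

lemma one_lt_rank_euclideanSpace {n : ℕ} :
    1 < Module.rank ℝ (EuclideanSpace ℝ (Fin (n + 2))) := by
  rw [← Module.finrank_eq_rank, finrank_euclideanSpace_fin]
  exact_mod_cast Nat.lt_of_sub_eq_succ rfl

lemma isPreconnected_compl_of_countable_of_mem {F : Set 𝕊²} (hF : F.Countable) {N : 𝕊²}
    (hN : N ∈ F) : IsPreconnected Fᶜ := by
  set σ := stereographic' 2 N
  have hsrc : σ.source = {N}ᶜ := stereographic'_source N
  have htgt : σ.target = Set.univ := stereographic'_target N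
  have hc : (σ '' F).Countable := hF.image _
  have hconn := ((hc.mono (Set.image_mono (f := σ)
    (Set.sdiff_subset : F \ {N} ⊆ F))).isPathConnected_compl_of_one_lt_rank
      one_lt_rank_euclideanSpace).isConnected.isPreconnected
  have hcont : Continuous σ.symm := by
    rw [← continuousOn_univ, ← htgt]
    exact σ.continuousOn_symm
  convert hconn.image σ.symm hcont.continuousOn using 1
  ext x
  constructor
  · intro hx
    have hxs : x ∈ σ.source := by
      rw [hsrc]
      rintro rfl
      exact hx hN
    refine ⟨σ x, ?_, σ.left_inv hxs⟩
    rintro ⟨y, ⟨hyF, hyN⟩, hyx⟩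
    have hys : y ∈ σ.source := by
      rw [hsrc]
      exact hyN
    rw [σ.injOn hys hxs hyx] at hyF
    exact hx hyF
  · rintro ⟨a, ha, rfl⟩ hxF
    have hat : a ∈ σ.target := by
      rw [htgt]
      trivial
    refine ha ⟨σ.symm a, ⟨hxF, ?_⟩, σ.right_inv hat⟩
    have := σ.map_target hat
    rwa [hsrc] at this

instance : Infinite 𝕊² := by
  have h : (sphere (0 : ℝ³) 1).Infinite := by
    refine (isConnected_sphere one_lt_rank_euclideanSpace 0 zero_le_one).isPreconnected
      |>.infinite_of_nontrivial ?_
    have hmem : EuclideanSpace.single 0 1 ∈ sphere (0 : ℝ³) 1 := by simp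
    exact ⟨_, hmem, -EuclideanSpace.single 0 1, by simp,
      fun h ↦ ne_neg_of_mem_unit_sphere ℝ ⟨_, hmem⟩ (Subtype.ext h)⟩
  exact h.to_subtype

theorem injective_of_isLocalHomeomorph_sphere {f : 𝕊² → 𝕊²} (hf : IsLocalHomeomorph f) :
    Function.Injective f := by
  have cov : IsCoveringMap f := isLocalHomeomorph_iff_isCoveringMap.1 hf
  have hfin (y : 𝕊²) : (f ⁻¹' {y}).Finite := by
    refine ((isClosed_singleton.preimage hf.continuous).isCompact).finite ?_
    exact ⟨(cov y).1⟩
  intro x₁ x₂ hx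
  obtain ⟨p, hp⟩ : ∃ p, f p ≠ f x₁ := by
    by_contra! h
    have huniv : f ⁻¹' {f x₁} = Set.univ := by
      ext p
      simpa using h p
    have := hfin (f x₁)
    rw [huniv] at this
    exact Set.infinite_univ this
  set N := f p
  set σ := stereographic' 2 N
  have hsrc : σ.source = {N}ᶜ := stereographic'_source N
  have htgt : σ.target = Set.univ := stereographic'_target N
  have hcont : Continuous σ.symm := by
    rw [← continuousOn_univ, ← htgt]
    exact σ.continuousOn_symm
  have hmem {x : 𝕊²} (h : f x ≠ N) : f x ∈ σ.source := by
    rw [hsrc]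
    exact h
  obtain ⟨F, ⟨hF₀, hF⟩, -⟩ := cov.existsUnique_continuousMap_lifts
    (⟨σ.symm, hcont⟩ : C(EuclideanSpace ℝ (Fin 2), 𝕊²)) (σ (f x₁)) x₁
    (σ.left_inv (hmem hp.symm)).symm
  have hconn : IsPreconnected (f ⁻¹' {N})ᶜ :=
    isPreconnected_compl_of_countable_of_mem (hfin N).countable (N := p) rfl
  have key : Set.EqOn (fun x ↦ F (σ (f x))) id (f ⁻¹' {N})ᶜ := by
    refine cov.eqOn_of_comp_eqOn hconn ?_ continuousOn_id ?_ (a := x₁) hp.symm hF₀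
    · refine F.continuous.comp_continuousOn ?_
      exact σ.continuousOn.comp hf.continuous.continuousOn fun x hx ↦ hmem hx
    · intro x hx
      have := congr_fun hF (σ (f x))
      simp only [Function.comp_apply, ContinuousMap.coe_mk] at this ⊢
      rw [this, σ.left_inv (hmem hx)]
      rfl
  have h₁ := key (x := x₁) hp.symm
  have h₂ := key (x := x₂) (by
    change f x₂ ≠ N
    rw [← hx]
    exact hp.symm)
  simp only [id] at h₁ h₂
  rw [← h₁, ← h₂, hx]

/-! ### Radial extension of maps on the sphere -/

/-- Radial projection onto the unit sphere (with a junk value at the origin). -/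
def toSphere (y : ℝ³) : 𝕊² :=
  if h : y = 0 then ⟨EuclideanSpace.single 0 1, by simp⟩
  else ⟨‖y‖⁻¹ • y, by simp [norm_smul, h]⟩

lemma coe_toSphere {y : ℝ³} (hy : y ≠ 0) : (toSphere y : ℝ³) = ‖y‖⁻¹ • y := by
  simp [toSphere, hy]

lemma norm_smul_toSphere {y : ℝ³} (hy : y ≠ 0) : ‖y‖ • (toSphere y : ℝ³) = y := by
  rw [coe_toSphere hy, smul_smul, mul_inv_cancel₀ (norm_ne_zero_iff.2 hy), one_smul]

@[simp]
lemma toSphere_coe (x : 𝕊²) : toSphere x = x := by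
  have hx : ‖(x : ℝ³)‖ = 1 := norm_eq_of_mem_sphere x
  ext1
  rw [coe_toSphere (ne_zero_of_mem_unit_sphere x), hx, inv_one, one_smul]

lemma toSphere_smul {c : ℝ} (hc : 0 < c) (y : ℝ³) : toSphere (c • y) = toSphere y := by
  rcases eq_or_ne y 0 with rfl | hy
  · simp
  ext1
  rw [coe_toSphere hy, coe_toSphere (smul_ne_zero hc.ne' hy), norm_smul, smul_smul,
    Real.norm_of_nonneg hc.le]
  congr 1
  field_simp

lemma contMDiffAt_toSphere {y : ℝ³} (hy : y ≠ 0) :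
    ContMDiffAt 𝓘(ℝ, ℝ³) (𝓡 2) (⊤ : ℕ∞) toSphere y := by
  let U : TopologicalSpace.Opens ℝ³ := ⟨{0}ᶜ, isOpen_compl_singleton⟩
  have hU : ContMDiff 𝓘(ℝ, ℝ³) 𝓘(ℝ, ℝ³) (⊤ : ℕ∞) (fun y : U ↦ ‖(y : ℝ³)‖⁻¹ • (y : ℝ³)) := by
    intro y
    have hy : (y : ℝ³) ≠ 0 := y.2
    refine contMDiffAt_subtype_iff (f := fun y : ℝ³ ↦ ‖y‖⁻¹ • y).2 ?_
    refine ContDiffAt.contMDiffAt ?_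
    exact ((contDiffAt_norm ℝ hy).inv (norm_ne_zero_iff.2 hy)).smul contDiffAt_id
  have hmem (y : U) : ‖(y : ℝ³)‖⁻¹ • (y : ℝ³) ∈ 𝕊² := by
    have hy : (y : ℝ³) ≠ 0 := y.2
    simp [norm_smul, hy]
  have h := hU.codRestrict_sphere (n := 2) hmem
  refine contMDiffAt_subtype_iff (U := U) (x := ⟨y, hy⟩).1 ?_
  have heq : (fun z : U ↦ toSphere z) = Set.codRestrict _ _ hmem := by
    ext1 z
    have hz : (z : ℝ³) ≠ 0 := z.2
    exact Subtype.ext (coe_toSphere hz)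
  rw [heq]
  exact h ⟨y, hy⟩

/-- The derivative of the radial projection. -/
def dToSphere (y : ℝ³) : ℝ³ →L[ℝ] TangentSpace (𝓡 2) (toSphere y) :=
  mfderiv 𝓘(ℝ, ℝ³) (𝓡 2) toSphere y

/-- The extension of a map on the sphere to a map on `ℝ³ ∖ 0` which is constant on rays. -/
def radialExt (f : 𝕊² → ℝ³) (y : ℝ³) : ℝ³ := f (toSphere y)

section radialExt

variable {f : 𝕊² → ℝ³} (hf : Smooth3 f) {y : ℝ³} (hy : y ≠ 0)

include hf hy

lemma Smooth3.contDiffAt_radialExt : ContDiffAt ℝ (⊤ : ℕ∞) (radialExt f) y :=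
  contMDiffAt_iff_contDiffAt.1 ((hf (toSphere y)).comp y (contMDiffAt_toSphere hy))

lemma Smooth3.contDiffAt_two_radialExt : ContDiffAt ℝ 2 (radialExt f) y :=
  (hf.contDiffAt_radialExt hy).of_le (WithTop.coe_le_coe.2 (le_top : (2 : ℕ∞) ≤ ⊤))

lemma Smooth3.fderiv_radialExt (v : ℝ³) :
    fderiv ℝ (radialExt f) y v = mfd f (toSphere y) (dToSphere y v) := by
  have h := mfderiv_comp y ((hf (toSphere y)).mdifferentiableAt (by simp))
    ((contMDiffAt_toSphere hy).mdifferentiableAt (by simp))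
  have h' : mfderiv 𝓘(ℝ, ℝ³) 𝓘(ℝ, ℝ³) (f ∘ toSphere) y = fderiv ℝ (radialExt f) y :=
    mfderiv_eq_fderiv
  rw [← h', h]
  rfl

lemma Smooth3.fderiv_radialExt_self : fderiv ℝ (radialExt f) y y = 0 := by
  have h := ((hf.contDiffAt_radialExt hy).differentiableAt (by simp)).hasFDerivAt.hasLineDerivAt y
  refine HasDerivAt.unique h ((hasDerivAt_const 0 (radialExt f y)).congr_of_eventuallyEq ?_)
  filter_upwards [lt_mem_nhds (show (-1 : ℝ) < 0 by norm_num)] with t ht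
  have : y + t • y = (1 + t) • y := by rw [add_smul, one_smul]
  rw [radialExt, radialExt, this, toSphere_smul (by linarith)]

end radialExt

lemma exists_eq_smul_of_dToSphere_eq_zero {y : ℝ³} (hy : y ≠ 0) {v : ℝ³}
    (hv : dToSphere y v = 0) : ∃ c : ℝ, v = c • y := by
  have hsm : Smooth3 ((↑) : 𝕊² → ℝ³) := contMDiff_coe_sphere
  have h := hsm.fderiv_radialExt hy v
  rw [hv, map_zero] at h
  have hd := ((hsm.contDiffAt_radialExt hy).differentiableAt (by simp)).hasFDerivAt
  have hn := ((contDiffAt_norm ℝ hy (n := 1)).differentiableAt (by simp)).hasFDerivAt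
  have hid : HasFDerivAt (fun z : ℝ³ ↦ z) _ y := (hn.smul hd).congr_of_eventuallyEq (by
    filter_upwards [isOpen_compl_singleton.mem_nhds hy] with z hz
    exact (norm_smul_toSphere hz).symm)
  have := DFunLike.congr_fun (hid.unique (hasFDerivAt_id y)) v
  simp only [add_apply, smul_apply, h, smul_zero, zero_add,
    ContinuousLinearMap.smulRight_apply, ContinuousLinearMap.id_apply] at this
  rw [← this, radialExt, coe_toSphere hy, smul_smul]
  exact ⟨_, rfl⟩

/-! ### The cross product -/

@[simp] lemma cross_apply_zero (a b : ℝ³) : cross a b 0 = a 1 * b 2 - a 2 * b 1 := by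
  simp [cross, crossProduct]

@[simp] lemma cross_apply_one (a b : ℝ³) : cross a b 1 = a 2 * b 0 - a 0 * b 2 := by
  simp [cross, crossProduct]

@[simp] lemma cross_apply_two (a b : ℝ³) : cross a b 2 = a 0 * b 1 - a 1 * b 0 := by
  simp [cross, crossProduct]

lemma real_inner_fin_three (a b : ℝ³) : ⟪a, b⟫ = a 0 * b 0 + a 1 * b 1 + a 2 * b 2 := by
  simp [PiLp.inner_apply, Fin.sum_univ_three, mul_comm]

lemma ext_fin_three {a b : ℝ³} (h₀ : a 0 = b 0) (h₁ : a 1 = b 1) (h₂ : a 2 = b 2) : a = b := by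
  ext i
  fin_cases i
  exacts [h₀, h₁, h₂]

@[simp] lemma zero_cross (a : ℝ³) : cross 0 a = 0 := by
  apply ext_fin_three <;> simp

@[simp] lemma cross_zero (a : ℝ³) : cross a 0 = 0 := by
  apply ext_fin_three <;> simp

lemma cross_smul_add_left (a b : ℝ) (u v : ℝ³) : cross (a • u + b • v) v = a • cross u v := by
  apply ext_fin_three <;> simp <;> ring

lemma cross_smul_add_right (a b : ℝ) (u v : ℝ³) : cross u (a • u + b • v) = b • cross u v := by
  apply ext_fin_three <;> simp <;> ring

lemma inner_smul_add_cross (a b : ℝ) (u v : ℝ³) : ⟪a • u + b • v, cross u v⟫ = 0 := by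
  simp [real_inner_fin_three]
  ring

lemma cross_cross_self (w y : ℝ³) : cross w (cross y w) = ⟪w, w⟫ • y - ⟪w, y⟫ • w := by
  apply ext_fin_three <;> simp only [real_inner_fin_three, PiLp.sub_apply,
      PiLp.smul_apply, smul_eq_mul, cross_apply_zero, cross_apply_one,
      cross_apply_two] <;> ring

lemma cross_smul_right (c : ℝ) (u v : ℝ³) : cross u (c • v) = c • cross u v := by
  apply ext_fin_three <;> simp <;> ring

lemma inner_cross_cross (a b c d : ℝ³) :
    ⟪cross a b, cross c d⟫ = ⟪a, c⟫ * ⟪b, d⟫ - ⟪a, d⟫ * ⟪b, c⟫ := by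
  simp only [real_inner_fin_three, cross_apply_zero, cross_apply_one, cross_apply_two]
  ring

/-- A nonzero vector orthogonal to `y` is a factor of `y` for the cross product. -/
lemma exists_cross_eq {w y : ℝ³} (hw : w ≠ 0) (hwy : ⟪w, y⟫ = 0) : ∃ v, cross w v = y := by
  refine ⟨⟪w, w⟫⁻¹ • cross y w, ?_⟩
  rw [cross_smul_right, cross_cross_self, hwy, zero_smul, sub_zero, smul_smul,
    inv_mul_cancel₀ (inner_self_ne_zero.2 hw), one_smul]

lemma exists_smul_add_orthogonal {y : ℝ³} (hy : y ≠ 0) (v : ℝ³) :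
    ∃ (c : ℝ) (w : ℝ³), v = c • y + w ∧ ⟪w, y⟫ = 0 := by
  refine ⟨⟪v, y⟫ / ⟪y, y⟫, v - (⟪v, y⟫ / ⟪y, y⟫) • y, by abel, ?_⟩
  rw [inner_sub_left, real_inner_smul_left, div_mul_cancel₀ _ (inner_self_ne_zero.2 hy), sub_self]

/-- A vector orthogonal to `a` and `b` is a multiple of `cross a b`, if the latter is nonzero. -/
lemma eq_smul_cross_of_inner_eq_zero {a b n : ℝ³} (hab : cross a b ≠ 0) (ha : ⟪n, a⟫ = 0)
    (hb : ⟪n, b⟫ = 0) : n = (⟪n, cross a b⟫ / ⟪cross a b, cross a b⟫) • cross a b := by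
  have h : ⟪cross a b, cross a b⟫ • n = ⟪n, cross a b⟫ • cross a b := by
    have h1 : ⟪cross a b, cross a b⟫ • n = ⟪n, cross a b⟫ • cross a b
        + (⟪n, a⟫ * ⟪b, b⟫ - ⟪n, b⟫ * ⟪a, b⟫) • a + (⟪n, b⟫ * ⟪a, a⟫ - ⟪n, a⟫ * ⟪a, b⟫) • b := by
      apply ext_fin_three <;> simp only [real_inner_fin_three, PiLp.add_apply,
      PiLp.smul_apply, smul_eq_mul, cross_apply_zero, cross_apply_one,
      cross_apply_two] <;> ring
    rw [h1, ha, hb]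
    simp
  rw [div_eq_inv_mul, mul_smul, ← h, smul_smul, inv_mul_cancel₀ (inner_self_ne_zero.2 hab),
    one_smul]

/-- A vector orthogonal to a nonzero vector orthogonal to `a` and `b` is a combination of them. -/
lemma exists_eq_smul_add_smul {a b n p : ℝ³} (hab : cross a b ≠ 0) (hn : n ≠ 0) (ha : ⟪n, a⟫ = 0)
    (hb : ⟪n, b⟫ = 0) (hp : ⟪n, p⟫ = 0) : ∃ s t : ℝ, p = s • a + t • b := by
  have hn' := eq_smul_cross_of_inner_eq_zero hab ha hb
  have hp' : ⟪cross a b, p⟫ = 0 := by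
    rw [hn', real_inner_smul_left, mul_eq_zero] at hp
    refine hp.resolve_left fun h ↦ hn ?_
    rw [hn', h, zero_smul]
  have h : ⟪cross a b, cross a b⟫ • p = ⟪cross p b, cross a b⟫ • a + ⟪cross a p, cross a b⟫ • b := by
    have h1 : ⟪cross a b, cross a b⟫ • p = ⟪cross p b, cross a b⟫ • a
        + ⟪cross a p, cross a b⟫ • b + ⟪cross a b, p⟫ • cross a b := by
      apply ext_fin_three <;> simp only [real_inner_fin_three, PiLp.add_apply,
      PiLp.smul_apply, smul_eq_mul, cross_apply_zero, cross_apply_one,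
      cross_apply_two] <;> ring
    rw [h1, hp']
    simp
  refine ⟨⟪cross a b, cross a b⟫⁻¹ * ⟪cross p b, cross a b⟫,
    ⟪cross a b, cross a b⟫⁻¹ * ⟪cross a p, cross a b⟫, ?_⟩
  rw [mul_smul, mul_smul, ← smul_add, ← h, smul_smul,
    inv_mul_cancel₀ (inner_self_ne_zero.2 hab), one_smul]

/-! ### The Gauss map -/

lemma linearIndependent_dToSphere {u v : ℝ³} (huv : cross u v ≠ 0) :
    LinearIndependent ℝ ![dToSphere (cross u v) u, dToSphere (cross u v) v] := by
  rw [LinearIndependent.pair_iff]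
  intro s t hst
  rw [← map_smul, ← map_smul, ← map_add] at hst
  obtain ⟨c, hc⟩ := exists_eq_smul_of_dToSphere_eq_zero huv hst
  have h0 : s • u + t • v = 0 := by
    rw [← inner_self_eq_zero (𝕜 := ℝ)]
    nth_rw 2 [hc]
    rw [inner_smul_right, inner_smul_add_cross, mul_zero]
  have h1 := cross_smul_add_left s t u v
  have h2 := cross_smul_add_right s t u v
  rw [h0, zero_cross, eq_comm, smul_eq_zero] at h1
  rw [h0, cross_zero, eq_comm, smul_eq_zero] at h2
  exact ⟨h1.resolve_right huv, h2.resolve_right huv⟩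

section GaussMap

variable {φ ν : 𝕊² → ℝ³} (hφ : Smooth3 φ) (hν : IsUnitNormalField φ ν)
  (hK : PosGaussCurvature φ ν)

include hν in
lemma IsUnitNormalField.inner_fderiv_self {y : ℝ³} (hy : y ≠ 0) (v : ℝ³) :
    ⟪radialExt ν y, fderiv ℝ (radialExt ν) y v⟫ = 0 := by
  have hd := ((hν.1.contDiffAt_radialExt hy).differentiableAt (by simp)).hasFDerivAt
  have h1 : HasFDerivAt (fun z ↦ ⟪radialExt ν z, radialExt ν z⟫) _ y := hd.inner ℝ hd
  have h2 : (fun z ↦ ⟪radialExt ν z, radialExt ν z⟫) = fun _ ↦ 1 := by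
    ext z
    rw [real_inner_self_eq_norm_sq, radialExt, hν.2.1, one_pow]
  rw [h2] at h1
  have := DFunLike.congr_fun (h1.unique (hasFDerivAt_const 1 y)) v
  simp [real_inner_comm] at this
  linarith

include hφ hν in
lemma IsUnitNormalField.inner_fderiv {y : ℝ³} (hy : y ≠ 0) (v : ℝ³) :
    ⟪radialExt ν y, fderiv ℝ (radialExt φ) y v⟫ = 0 := by
  rw [hφ.fderiv_radialExt hy]
  exact hν.2.2 _ _

include hφ hν hK in
lemma PosGaussCurvature.inner_cross_fderiv_pos {u v y : ℝ³} (huv : cross u v = y) (hy : y ≠ 0) :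
    0 < ⟪cross (fderiv ℝ (radialExt ν) y u) (fderiv ℝ (radialExt ν) y v),
      cross (fderiv ℝ (radialExt φ) y u) (fderiv ℝ (radialExt φ) y v)⟫ := by
  subst huv
  simp only [hφ.fderiv_radialExt hy, hν.1.fderiv_radialExt hy]
  exact hK _ _ _ (linearIndependent_dToSphere hy)

include hφ hν hK in
lemma PosGaussCurvature.exists_eq_smul {y v : ℝ³} (hy : y ≠ 0)
    (hv : fderiv ℝ (radialExt ν) y v = 0) : ∃ c : ℝ, v = c • y := by
  obtain ⟨c, w, rfl, hw⟩ := exists_smul_add_orthogonal hy v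
  rcases eq_or_ne w 0 with rfl | hw0
  · exact ⟨c, by simp⟩
  obtain ⟨z, hz⟩ := exists_cross_eq hw0 hw
  have h := hK.inner_cross_fderiv_pos hφ hν hz hy
  rw [map_add, map_smul, hν.1.fderiv_radialExt_self hy, smul_zero, zero_add] at hv
  simp [hv] at h

/-- The Gauss map as a map between spheres. -/
def gaussMap (hν : IsUnitNormalField φ ν) (x : 𝕊²) : 𝕊² := ⟨ν x, by simp [hν.2.1]⟩

lemma continuous_gaussMap : Continuous (gaussMap hν) :=
  hν.1.continuous.subtype_mk _

include hφ hν hK in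
/-- The `1`-homogeneous extension of the Gauss map is a local diffeomorphism. -/
lemma PosGaussCurvature.exists_hasStrictFDerivAt (x : 𝕊²) :
    ∃ L : ℝ³ ≃L[ℝ] ℝ³, HasStrictFDerivAt (fun y : ℝ³ ↦ ‖y‖ • radialExt ν y)
      (L : ℝ³ →L[ℝ] ℝ³) (x : ℝ³) := by
  have hx : (x : ℝ³) ≠ 0 := ne_zero_of_mem_unit_sphere x
  have hc : ContDiffAt ℝ (⊤ : ℕ∞) (fun y : ℝ³ ↦ ‖y‖ • radialExt ν y) x :=
    (contDiffAt_norm ℝ hx).smul (hν.1.contDiffAt_radialExt hx)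
  have hn := ((contDiffAt_norm ℝ hx (n := 1)).differentiableAt (by simp)).hasFDerivAt
  have hd : HasFDerivAt (fun y : ℝ³ ↦ ‖y‖ • radialExt ν y) _ x :=
    hn.smul ((hν.1.contDiffAt_radialExt hx).differentiableAt (by simp)).hasFDerivAt
  have hs := hc.hasStrictFDerivAt (by simp)
  have hnx : fderiv ℝ (fun y : ℝ³ ↦ ‖y‖) x x = 1 := by
    rw [hn.differentiableAt.fderiv_norm_self, norm_eq_of_mem_sphere]
  have hinj : Function.Injective (fderiv ℝ (fun y : ℝ³ ↦ ‖y‖ • radialExt ν y) x) := by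
    rw [injective_iff_map_eq_zero]
    intro v hv
    rw [hd.fderiv] at hv
    simp only [add_apply, ContinuousLinearMap.smulRight_apply,
      norm_eq_of_mem_sphere, one_smul] at hv
    have h1 := congr_arg (fun w ↦ ⟪radialExt ν x, w⟫) hv
    rw [inner_add_right, hν.inner_fderiv_self hx, inner_smul_right, real_inner_self_eq_norm_sq,
      radialExt, hν.2.1, inner_zero_right, one_pow, mul_one, zero_add] at h1
    rw [h1, zero_smul, add_zero] at hv
    obtain ⟨c, rfl⟩ := hK.exists_eq_smul hφ hν hx hv
    rw [map_smul, hnx, smul_eq_mul, mul_one] at h1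
    rw [h1, zero_smul]
  have hL : ((LinearEquiv.ofInjectiveEndo _ hinj).toContinuousLinearEquiv : ℝ³ →L[ℝ] ℝ³) =
      fderiv ℝ (fun y : ℝ³ ↦ ‖y‖ • radialExt ν y) x := ContinuousLinearMap.ext fun _ ↦ rfl
  exact ⟨_, hL ▸ hs⟩

include hφ hν hK in
theorem PosGaussCurvature.isLocalHomeomorph_gaussMap : IsLocalHomeomorph (gaussMap hν) := by
  have hcont := continuous_gaussMap hν
  have hopen : IsOpenMap (gaussMap hν) := by
    refine isOpenMap_iff_nhds_le.2 fun x S hS ↦ ?_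
    obtain ⟨L, hL⟩ := hK.exists_hasStrictFDerivAt hφ hν x
    have hx : (x : ℝ³) ≠ 0 := ne_zero_of_mem_unit_sphere x
    have h1 : toSphere ⁻¹' (gaussMap hν ⁻¹' S) ∈ nhds (x : ℝ³) := by
      refine (contMDiffAt_toSphere hx).continuousAt ?_
      rw [toSphere_coe]
      exact hS
    have h2 := Filter.image_mem_map (m := fun y : ℝ³ ↦ ‖y‖ • radialExt ν y)
      (Filter.inter_mem h1 (isOpen_compl_singleton.mem_nhds hx))
    rw [hL.map_nhds_eq_of_equiv, norm_eq_of_mem_sphere, one_smul, radialExt, toSphere_coe] at h2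
    have h3 := (continuous_subtype_val (p := fun z : ℝ³ ↦ z ∈ 𝕊²)).continuousAt
      (x := gaussMap hν x) h2
    filter_upwards [h3] with z hz
    obtain ⟨y, ⟨hyS, hy0⟩, hyz⟩ := hz
    have hn := congr_arg norm hyz
    simp only [norm_smul, norm_norm, radialExt, hν.2.1, mul_one, norm_eq_of_mem_sphere] at hn
    simp only [hn, one_smul] at hyz
    have : z = gaussMap hν (toSphere y) := Subtype.ext hyz.symm
    rw [this]
    exact hyS
  refine isLocalHomeomorph_iff_isOpenEmbedding_restrict.2 fun x ↦ ?_
  obtain ⟨L, hL⟩ := hK.exists_hasStrictFDerivAt hφ hν x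
  set e := hL.toOpenPartialHomeomorph
  have hW : IsOpen ((↑) ⁻¹' e.source : Set 𝕊²) := e.open_source.preimage continuous_subtype_val
  refine ⟨_, hW.mem_nhds hL.mem_toOpenPartialHomeomorph_source, ?_⟩
  refine .of_continuous_injective_isOpenMap (hcont.comp continuous_subtype_val) ?_
    (hopen.comp hW.isOpenMap_subtype_val)
  rw [← Set.injOn_iff_injective]
  intro a ha b hb hab
  refine Subtype.ext (e.injOn ha hb ?_)
  have h : ν a = ν b := congr_arg Subtype.val hab
  simp [e, radialExt, h]

include hφ hν hK in
theorem PosGaussCurvature.injective_normal : Function.Injective ν := fun _ _ hab ↦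
  injective_of_isLocalHomeomorph_sphere (hK.isLocalHomeomorph_gaussMap hφ hν) (Subtype.ext hab)

end GaussMap

/-! ### Support functions of strictly convex surfaces -/

lemma exists_cross_eq_self (y : ℝ³) : ∃ u v, cross u v = y := by
  obtain ⟨w, hw, hwy⟩ : ∃ w : ℝ³, w ≠ 0 ∧ ⟪w, y⟫ = 0 := by
    by_cases h : y 0 = 0
    · refine ⟨EuclideanSpace.single 0 1, by simp, by simpa [real_inner_fin_three] using h⟩
    · refine ⟨!₂[-y 1, y 0, 0], fun h0 ↦ h ?_, ?_⟩
      · simpa using congr_arg (fun w : ℝ³ ↦ w 1) h0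
      · simp [real_inner_fin_three]
        ring
  exact ⟨w, exists_cross_eq hw hwy⟩

section Convexity

variable {φ ν : 𝕊² → ℝ³} (hφ : Smooth3 φ) (hν : IsUnitNormalField φ ν)
  (hK : PosGaussCurvature φ ν)

include hφ hν hK

/-- At a critical point of a height function, the normal is the direction of the height. -/
lemma PosGaussCurvature.normal_eq_or_eq_neg {u : ℝ³} (hu : ‖u‖ = 1) {x : 𝕊²}
    (hx : (∀ y, ⟪φ y, u⟫ ≤ ⟪φ x, u⟫) ∨ ∀ y, ⟪φ x, u⟫ ≤ ⟪φ y, u⟫) : ν x = u ∨ ν x = -u := by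
  have hx0 : (x : ℝ³) ≠ 0 := ne_zero_of_mem_unit_sphere x
  have hd := ((hφ.contDiffAt_radialExt hx0).differentiableAt (by simp)).hasFDerivAt
  have hdu : HasFDerivAt (fun z ↦ ⟪radialExt φ z, u⟫) _ (x : ℝ³) :=
    hd.inner ℝ (hasFDerivAt_const u _)
  have hext : IsLocalExtr (fun z ↦ ⟪radialExt φ z, u⟫) (x : ℝ³) := by
    rcases hx with hx | hx
    · right
      refine Filter.Eventually.of_forall fun z ↦ ?_
      simpa [radialExt] using hx (toSphere z)
    · left
      refine Filter.Eventually.of_forall fun z ↦ ?_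
      simpa [radialExt] using hx (toSphere z)
  have hcrit (v : ℝ³) : ⟪u, fderiv ℝ (radialExt φ) x v⟫ = 0 := by
    have := DFunLike.congr_fun (hext.hasFDerivAt_eq_zero hdu) v
    simpa [real_inner_comm] using this
  obtain ⟨a, b, hab⟩ := exists_cross_eq_self (x : ℝ³)
  have hpos := hK.inner_cross_fderiv_pos hφ hν hab hx0
  have hne : cross (fderiv ℝ (radialExt φ) x a) (fderiv ℝ (radialExt φ) x b) ≠ 0 := by
    intro h
    rw [h, inner_zero_right] at hpos
    exact hpos.false
  have h1 := eq_smul_cross_of_inner_eq_zero hne (hcrit a) (hcrit b)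
  have h2 := eq_smul_cross_of_inner_eq_zero hne (hν.inner_fderiv hφ hx0 a)
    (hν.inner_fderiv hφ hx0 b)
  rw [radialExt, toSphere_coe] at h2
  set n := cross (fderiv ℝ (radialExt φ) x a) (fderiv ℝ (radialExt φ) x b)
  set s := ⟪u, n⟫ / ⟪n, n⟫
  set t := ⟪ν x, n⟫ / ⟪n, n⟫
  have hst : |s| = |t| := by
    have h3 : ‖s • n‖ = ‖t • n‖ := by rw [← h1, ← h2, hu, hν.2.1]
    rw [norm_smul, norm_smul] at h3
    exact mul_right_cancel₀ (norm_ne_zero_iff.2 hne) h3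
  rcases abs_eq_abs.1 hst with h | h
  · left
    rw [h1, h2, h]
  · right
    rw [h1, h2, h, neg_smul, neg_neg]

lemma PosGaussCurvature.height_lt_or_lt (x : 𝕊²) :
    (∀ y ≠ x, ⟪φ y, ν x⟫ < ⟪φ x, ν x⟫) ∨ ∀ y ≠ x, ⟪φ x, ν x⟫ < ⟪φ y, ν x⟫ := by
  have hinj := hK.injective_normal hφ hν
  have hcont : Continuous fun y ↦ ⟪φ y, ν x⟫ := hφ.continuous.inner continuous_const
  obtain ⟨M, -, hM⟩ := isCompact_univ.exists_isMaxOn Set.univ_nonempty hcont.continuousOn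
  obtain ⟨m, -, hm⟩ := isCompact_univ.exists_isMinOn Set.univ_nonempty hcont.continuousOn
  have hM (y : 𝕊²) : ⟪φ y, ν x⟫ ≤ ⟪φ M, ν x⟫ := hM (Set.mem_univ y)
  have hm (y : 𝕊²) : ⟪φ m, ν x⟫ ≤ ⟪φ y, ν x⟫ := hm (Set.mem_univ y)
  have hcrit {y : 𝕊²} (hy : ⟪φ y, ν x⟫ = ⟪φ M, ν x⟫ ∨ ⟪φ y, ν x⟫ = ⟪φ m, ν x⟫) :
      ν y = ν x ∨ ν y = -ν x := by
    refine hK.normal_eq_or_eq_neg hφ hν (hν.2.1 x) ?_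
    rcases hy with hy | hy
    · exact .inl fun z ↦ hy ▸ hM z
    · exact .inr fun z ↦ hy ▸ hm z
  have hlt : ⟪φ m, ν x⟫ < ⟪φ M, ν x⟫ := by
    refine (hm M).lt_of_ne fun heq ↦ ?_
    have hfin : (ν ⁻¹' {ν x, -ν x}).Finite := (Set.toFinite _).preimage hinj.injOn
    refine Set.infinite_univ (hfin.subset fun y _ ↦ ?_)
    exact hcrit (.inl (le_antisymm (hM y) (heq ▸ hm y)))
  have hx : ⟪φ x, ν x⟫ = ⟪φ M, ν x⟫ ∨ ⟪φ x, ν x⟫ = ⟪φ m, ν x⟫ := by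
    rcases hcrit (.inl rfl : _ ∨ ⟪φ M, ν x⟫ = ⟪φ m, ν x⟫) with h | h
    · left; rw [hinj h]
    rcases hcrit (.inr rfl : ⟪φ m, ν x⟫ = ⟪φ M, ν x⟫ ∨ _) with h' | h'
    · right; rw [hinj h']
    · rw [hinj (h.trans h'.symm)] at hlt
      exact absurd hlt (lt_irrefl _)
  have huniq {y z : 𝕊²} (hy : ⟪φ y, ν x⟫ = ⟪φ x, ν x⟫) (hyx : y ≠ x)
      (hz : ⟪φ z, ν x⟫ ≠ ⟪φ x, ν x⟫) : ¬ (⟪φ z, ν x⟫ = ⟪φ M, ν x⟫ ∨ ⟪φ z, ν x⟫ = ⟪φ m, ν x⟫) := by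
    intro hz'
    have h1 := (hcrit hz').resolve_left fun h ↦ hz (by rw [hinj h])
    have h2 := (hcrit (hy ▸ hx)).resolve_left fun h ↦ hyx (hinj h)
    exact hz (by rw [hinj (h1.trans h2.symm), hy])
  rcases hx with h | h
  · left
    intro y hy
    refine lt_of_le_of_ne (h ▸ hM y) fun heq ↦ ?_
    exact huniq heq hy (z := m) (by rw [h]; exact hlt.ne) (.inr rfl)
  · right
    intro y hy
    refine lt_of_le_of_ne (h ▸ hm y) fun heq ↦ ?_
    exact huniq heq.symm hy (z := M) (by rw [h]; exact hlt.ne') (.inl rfl)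

theorem PosGaussCurvature.exists_inner_sub_ne_zero : ∃ p, ∀ x, ⟪φ x - p, ν x⟫ ≠ 0 := by
  obtain ⟨a, b, hab⟩ := exists_pair_ne 𝕊²
  refine ⟨(2⁻¹ : ℝ) • (φ a + φ b), fun x ↦ ?_⟩
  have heq : ⟪φ x - (2⁻¹ : ℝ) • (φ a + φ b), ν x⟫ =
      ⟪φ x, ν x⟫ - 2⁻¹ * (⟪φ a, ν x⟫ + ⟪φ b, ν x⟫) := by
    rw [inner_sub_left, real_inner_smul_left, inner_add_left]
  rw [heq]
  rcases hK.height_lt_or_lt hφ hν x with h | h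
  · have h' (y : 𝕊²) : ⟪φ y, ν x⟫ ≤ ⟪φ x, ν x⟫ := by
      rcases eq_or_ne y x with rfl | hy
      exacts [le_rfl, (h y hy).le]
    rcases eq_or_ne a x with rfl | ha
    · linarith [h b hab.symm]
    · linarith [h a ha, h' b]
  · have h' (y : 𝕊²) : ⟪φ x, ν x⟫ ≤ ⟪φ y, ν x⟫ := by
      rcases eq_or_ne y x with rfl | hy
      exacts [le_rfl, (h y hy).le]
    rcases eq_or_ne a x with rfl | ha
    · linarith [h b hab.symm]
    · linarith [h a ha, h' b]

end Convexity

/-! ### Infinitesimal deformations at a point -/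

/-- If the determinant of the second fundamental form is positive, then a trace-free endomorphism
which is self-adjoint for it has nonpositive determinant, and vanishes if its determinant does. -/
lemma add_mul_nonneg_of_pos {α β γ L M N : ℝ} (hpos : 0 < L * N - M * M)
    (hsymm : 2 * α * M + β * N = γ * L) :
    0 ≤ α * α + β * γ ∧ (α * α + β * γ = 0 → α = 0 ∧ β = 0 ∧ γ = 0) := by
  have hLN : 0 < L * N := by nlinarith [mul_self_nonneg M]
  have hkey : 4 * (L * N) * (α * α + β * γ) =
      (γ * L + β * N) ^ 2 + 4 * (L * N - M * M) * α ^ 2 := by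
    have h : (2 * α * M) ^ 2 = (γ * L - β * N) ^ 2 := by
      rw [← hsymm]
      ring
    linear_combination h
  have h₁ : 0 ≤ (L * N - M * M) * α ^ 2 := by positivity
  refine ⟨?_, fun h ↦ ?_⟩
  · refine nonneg_of_mul_nonneg_right (a := 4 * (L * N)) ?_ (by positivity)
    rw [hkey]
    nlinarith [sq_nonneg (γ * L + β * N)]
  · rw [h, mul_zero] at hkey
    have hα : α ^ 2 = 0 := by
      have : (L * N - M * M) * α ^ 2 = 0 := by nlinarith [sq_nonneg (γ * L + β * N)]
      exact (mul_eq_zero.1 this).resolve_left hpos.ne'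
    have hα : α = 0 := by simpa using hα
    subst hα
    have h₂ : γ * L + β * N = 0 := by
      have : (γ * L + β * N) ^ 2 = 0 := by linarith
      simpa using this
    have hL : L ≠ 0 := left_ne_zero_of_mul hLN.ne'
    have hN : N ≠ 0 := right_ne_zero_of_mul hLN.ne'
    refine ⟨rfl, ?_, ?_⟩
    · exact (mul_eq_zero.1 (show β * N = 0 by linarith)).resolve_right hN
    · exact (mul_eq_zero.1 (show γ * L = 0 by linarith)).resolve_right hL

lemma exists_cross_eq_neg_smul_cross {a b p q m n ν : ℝ³} (hν : ν ≠ 0)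
    (hpos : 0 < ⟪cross m n, cross a b⟫) (ha : ⟪ν, a⟫ = 0) (hb : ⟪ν, b⟫ = 0) (hp : ⟪ν, p⟫ = 0)
    (hq : ⟪ν, q⟫ = 0) (hab : ⟪a, n⟫ = ⟪b, m⟫) (hpq : ⟪p, n⟫ = ⟪q, m⟫)
    (h : cross p b + cross a q = 0) :
    ∃ κ : ℝ, 0 ≤ κ ∧ cross p q = -κ • cross a b ∧ (κ = 0 → p = 0 ∧ q = 0) := by
  have hne : cross a b ≠ 0 := by
    intro h0
    rw [h0, inner_zero_right] at hpos
    exact hpos.false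
  obtain ⟨α, β, rfl⟩ := exists_eq_smul_add_smul hne hν ha hb hp
  obtain ⟨γ, δ, rfl⟩ := exists_eq_smul_add_smul hne hν ha hb hq
  rw [cross_smul_add_left, cross_smul_add_right, ← add_smul, smul_eq_zero, or_iff_left hne] at h
  obtain rfl : δ = -α := by linarith
  rw [inner_cross_cross, real_inner_comm, real_inner_comm b n, real_inner_comm b m,
    real_inner_comm a n, hab] at hpos
  simp only [inner_add_left, real_inner_smul_left] at hpq
  rw [hab] at hpq
  obtain ⟨h₁, h₂⟩ := add_mul_nonneg_of_pos (α := α) (β := β) (γ := γ) hpos (by linarith)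
  refine ⟨_, h₁, ?_, fun h0 ↦ ?_⟩
  · apply ext_fin_three <;> simp <;> ring
  · obtain ⟨rfl, rfl, rfl⟩ := h₂ h0
    simp

lemma inner_fderiv_comm_of_inner_fderiv_eq_zero {F N : ℝ³ → ℝ³} {y : ℝ³} (hF : ContDiffAt ℝ 2 F y)
    (hN : DifferentiableAt ℝ N y) (h : ∀ᶠ z in nhds y, ∀ v, ⟪N z, fderiv ℝ F z v⟫ = 0) (v w : ℝ³) :
    ⟪fderiv ℝ F y v, fderiv ℝ N y w⟫ = ⟪fderiv ℝ F y w, fderiv ℝ N y v⟫ := by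
  have hd : HasFDerivAt (fderiv ℝ F) _ y :=
    ((hF.fderiv_right (m := 1) (by norm_num)).differentiableAt (by simp)).hasFDerivAt
  have key (v w : ℝ³) :
      ⟪fderiv ℝ F y v, fderiv ℝ N y w⟫ = -⟪N y, fderiv ℝ (fderiv ℝ F) y w v⟫ := by
    have h1 : HasFDerivAt (fun z ↦ ⟪N z, fderiv ℝ F z v⟫) _ y :=
      hN.hasFDerivAt.inner ℝ (hd.clm_apply (hasFDerivAt_const v y))
    have h2 : HasFDerivAt (fun z ↦ ⟪N z, fderiv ℝ F z v⟫) (0 : ℝ³ →L[ℝ] ℝ) y :=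
      (hasFDerivAt_const 0 y).congr_of_eventuallyEq (h.mono fun z hz ↦ hz v)
    have := DFunLike.congr_fun (h1.unique h2) w
    simp [real_inner_comm] at this
    linarith
  have hs : IsSymmSndFDerivAt ℝ F y := hF.isSymmSndFDerivAt (by simp)
  rw [key, key, hs.eq]

section Deformation

variable {φ ν η : 𝕊² → ℝ³} (hφ : Smooth3 φ) (hν : IsUnitNormalField φ ν)
  (hK : PosGaussCurvature φ ν) (hη : IsIsogaussDeformation φ ν η)

include hφ hη in
lemma IsIsogaussDeformation.cross_fderiv {y : ℝ³} (hy : y ≠ 0) (u v : ℝ³) :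
    cross (fderiv ℝ (radialExt η) y u) (fderiv ℝ (radialExt φ) y v) +
      cross (fderiv ℝ (radialExt φ) y u) (fderiv ℝ (radialExt η) y v) = 0 := by
  simp only [hφ.fderiv_radialExt hy, hη.1.fderiv_radialExt hy]
  exact hη.2.2 _ _ _

include hη in
lemma IsIsogaussDeformation.inner_fderiv {y : ℝ³} (hy : y ≠ 0) (v : ℝ³) :
    ⟪radialExt ν y, fderiv ℝ (radialExt η) y v⟫ = 0 := by
  rw [hη.1.fderiv_radialExt hy, real_inner_comm]
  exact hη.2.1 _ _

include hφ hν hK hη in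
lemma IsIsogaussDeformation.exists_cross_fderiv_eq {u v y : ℝ³} (huv : cross u v = y)
    (hy : y ≠ 0) :
    ∃ κ : ℝ, 0 ≤ κ ∧ cross (fderiv ℝ (radialExt η) y u) (fderiv ℝ (radialExt η) y v) =
      -κ • cross (fderiv ℝ (radialExt φ) y u) (fderiv ℝ (radialExt φ) y v) ∧
      (κ = 0 → fderiv ℝ (radialExt η) y u = 0 ∧ fderiv ℝ (radialExt η) y v = 0) := by
  have hev := isOpen_compl_singleton.mem_nhds hy
  have hν' := (hν.1.contDiffAt_radialExt hy).differentiableAt (by simp)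
  have hν0 : radialExt ν y ≠ 0 := by
    rw [← norm_ne_zero_iff, radialExt, hν.2.1]
    exact one_ne_zero
  refine exists_cross_eq_neg_smul_cross hν0 (hK.inner_cross_fderiv_pos hφ hν huv hy)
    (hν.inner_fderiv hφ hy u) (hν.inner_fderiv hφ hy v) (hη.inner_fderiv hy u)
    (hη.inner_fderiv hy v) ?_ ?_ (hη.cross_fderiv hφ hy u v)
  · refine inner_fderiv_comm_of_inner_fderiv_eq_zero (hφ.contDiffAt_two_radialExt hy) hν' ?_ u v
    filter_upwards [hev] with z hz using hν.inner_fderiv hφ hz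
  · refine inner_fderiv_comm_of_inner_fderiv_eq_zero (hη.1.contDiffAt_two_radialExt hy) hν' ?_ u v
    filter_upwards [hev] with z hz using hη.inner_fderiv hz

end Deformation

/-! ### Calculus of cross products -/

lemma integral_fderiv_eq_zero {F : ℝ³ → ℝ} (hF : ContDiff ℝ 1 F) (hc : HasCompactSupport F)
    (v : ℝ³) : ∫ y, fderiv ℝ F y v = 0 := by
  have h := integral_mul_fderiv_eq_neg_fderiv_mul_of_integrable (f := fun _ : ℝ³ ↦ (1 : ℝ))
    (g := F) (v := v) (μ := MeasureTheory.volume) (by simp) ?_ ?_ (by fun_prop)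
    (fun y _ ↦ hF.differentiable (by simp) y)
  · simpa using h
  · simpa using ((hF.continuous_fderiv (by simp)).clm_apply
      continuous_const).integrable_of_hasCompactSupport (hc.fderiv_apply ℝ v)
  · simpa using hF.continuous.integrable_of_hasCompactSupport hc

/-- The cross product as a continuous bilinear map. -/
def crossCLM : ℝ³ →L[ℝ] ℝ³ →L[ℝ] ℝ³ :=
  (LinearMap.mk₂ ℝ cross
    (fun _ _ _ ↦ by apply ext_fin_three <;> simp <;> ring)
    (fun _ _ _ ↦ by apply ext_fin_three <;> simp <;> ring)
    (fun _ _ _ ↦ by apply ext_fin_three <;> simp <;> ring)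
    (fun _ _ _ ↦ by apply ext_fin_three <;> simp <;> ring)).toContinuousBilinearMap

lemma crossCLM_apply (a b : ℝ³) : crossCLM a b = cross a b := rfl

section CrossCalculus

variable {f g : ℝ³ → ℝ³} {y : ℝ³}

lemma ContDiffAt.cross {n : WithTop ℕ∞} (hf : ContDiffAt ℝ n f y) (hg : ContDiffAt ℝ n g y) :
    ContDiffAt ℝ n (fun z ↦ cross (f z) (g z)) y :=
  crossCLM.isBoundedBilinearMap.contDiff.contDiffAt.comp y (hf.prodMk hg)

lemma fderiv_cross (hf : DifferentiableAt ℝ f y) (hg : DifferentiableAt ℝ g y) (v : ℝ³) :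
    fderiv ℝ (fun z ↦ cross (f z) (g z)) y v =
      cross (f y) (fderiv ℝ g y v) + cross (fderiv ℝ f y v) (g y) := by
  have h := crossCLM.hasFDerivAt_of_bilinear hf.hasFDerivAt hg.hasFDerivAt
  have h' : HasFDerivAt (fun z ↦ cross (f z) (g z)) _ y := h
  rw [h'.fderiv]
  simp [crossCLM_apply]

end CrossCalculus

/-- The antisymmetrized derivative of the one-form `⟪Φ × H, dH⟫`, for a deformation `H` of `Φ`
which preserves the area form to first order. -/
lemma fderiv_inner_cross_sub {Φ H : ℝ³ → ℝ³} {y : ℝ³} (hΦ : DifferentiableAt ℝ Φ y)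
    (hH : ContDiffAt ℝ 2 H y) {u v : ℝ³}
    (h : cross (fderiv ℝ H y u) (fderiv ℝ Φ y v) + cross (fderiv ℝ Φ y u) (fderiv ℝ H y v) = 0) :
    fderiv ℝ (fun z ↦ ⟪cross (Φ z) (H z), fderiv ℝ H z v⟫) y u -
      fderiv ℝ (fun z ↦ ⟪cross (Φ z) (H z), fderiv ℝ H z u⟫) y v =
      2 * ⟪Φ y, cross (fderiv ℝ H y u) (fderiv ℝ H y v)⟫ := by
  have hd : DifferentiableAt ℝ (fderiv ℝ H) y :=
    (hH.fderiv_right (m := 1) (by norm_num)).differentiableAt (by simp)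
  have hH' : DifferentiableAt ℝ H y := hH.differentiableAt (by simp)
  have hc : DifferentiableAt ℝ (fun z ↦ cross (Φ z) (H z)) y :=
    (crossCLM.hasFDerivAt_of_bilinear hΦ.hasFDerivAt hH'.hasFDerivAt).differentiableAt
  have key (u v : ℝ³) : fderiv ℝ (fun z ↦ ⟪cross (Φ z) (H z), fderiv ℝ H z v⟫) y u =
      ⟪cross (Φ y) (H y), fderiv ℝ (fderiv ℝ H) y u v⟫ +
      ⟪cross (Φ y) (fderiv ℝ H y u) + cross (fderiv ℝ Φ y u) (H y), fderiv ℝ H y v⟫ := by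
    rw [fderiv_inner_apply ℝ hc (hd.clm_apply (differentiableAt_const v)), fderiv_cross hΦ hH',
      fderiv_clm_apply hd (differentiableAt_const v)]
    simp
  have hs : IsSymmSndFDerivAt ℝ H y := hH.isSymmSndFDerivAt (by simp)
  rw [key, key, hs.eq u v]
  have h' := congr_arg (fun w ↦ ⟪H y, w⟫) h
  rw [inner_zero_right] at h'
  simp only [real_inner_fin_three, PiLp.add_apply, cross_apply_zero, cross_apply_one,
    cross_apply_two] at h' ⊢
  linear_combination -h'

/-- The divergence of `g • (y × b)` where `g` is a radial function. -/
lemma divergence_smul_cross_self {g : ℝ³ → ℝ} {b : Fin 3 → ℝ³ → ℝ} {y : ℝ³} {c : ℝ}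
    (hg : HasFDerivAt g (c • innerSL ℝ y) y) (hb : ∀ i, DifferentiableAt ℝ (b i) y) :
    fderiv ℝ (fun z ↦ g z * (z 1 * b 2 z - z 2 * b 1 z)) y (EuclideanSpace.single 0 1) +
      fderiv ℝ (fun z ↦ g z * (z 2 * b 0 z - z 0 * b 2 z)) y (EuclideanSpace.single 1 1) +
      fderiv ℝ (fun z ↦ g z * (z 0 * b 1 z - z 1 * b 0 z)) y (EuclideanSpace.single 2 1) =
    -g y * (y 0 * (fderiv ℝ (b 2) y (EuclideanSpace.single 1 1) -
        fderiv ℝ (b 1) y (EuclideanSpace.single 2 1)) +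
      y 1 * (fderiv ℝ (b 0) y (EuclideanSpace.single 2 1) -
        fderiv ℝ (b 2) y (EuclideanSpace.single 0 1)) +
      y 2 * (fderiv ℝ (b 1) y (EuclideanSpace.single 0 1) -
        fderiv ℝ (b 0) y (EuclideanSpace.single 1 1))) := by
  have hp (i : Fin 3) : HasFDerivAt (fun z : ℝ³ ↦ z i) (EuclideanSpace.proj (𝕜 := ℝ) i) y :=
    (EuclideanSpace.proj (𝕜 := ℝ) i).hasFDerivAt
  have key (i j : Fin 3) (v : ℝ³) : fderiv ℝ (fun z ↦ g z * (z i * b j z - z j * b i z)) y v =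
      g y * (y i * fderiv ℝ (b j) y v + b j y * v i - (y j * fderiv ℝ (b i) y v + b i y * v j)) +
        (y i * b j y - y j * b i y) * (c * ⟪y, v⟫) := by
    have h : HasFDerivAt (fun z ↦ g z * (z i * b j z - z j * b i z)) _ y :=
      hg.mul (((hp i).mul (hb j).hasFDerivAt).sub ((hp j).mul (hb i).hasFDerivAt))
    rw [h.fderiv]
    simp
  simp only [key, real_inner_fin_three]
  simp
  ring

/-- The image of `y = u × v` under the map induced by `L` on bivectors. -/
def crossMap (L : ℝ³ →L[ℝ] ℝ³) (y : ℝ³) : ℝ³ :=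
  y 0 • cross (L (EuclideanSpace.single 1 1)) (L (EuclideanSpace.single 2 1)) +
  y 1 • cross (L (EuclideanSpace.single 2 1)) (L (EuclideanSpace.single 0 1)) +
  y 2 • cross (L (EuclideanSpace.single 0 1)) (L (EuclideanSpace.single 1 1))

lemma crossMap_cross (L : ℝ³ →L[ℝ] ℝ³) (u v : ℝ³) :
    crossMap L (cross u v) = cross (L u) (L v) := by
  have hL (w : ℝ³) : L w = w 0 • L (EuclideanSpace.single 0 1) +
      w 1 • L (EuclideanSpace.single 1 1) + w 2 • L (EuclideanSpace.single 2 1) := by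
    rw [← map_smul, ← map_smul, ← map_smul, ← map_add, ← map_add]
    congr 1
    apply ext_fin_three <;> simp
  rw [hL u, hL v, crossMap]
  apply ext_fin_three <;> simp <;> ring

section Integral

variable {Φ H : ℝ³ → ℝ³} {g c : ℝ³ → ℝ}

lemma continuousAt_inner_crossMap {y : ℝ³} (hΦ : ContinuousAt Φ y) (hH : ContDiffAt ℝ 1 H y) :
    ContinuousAt (fun y ↦ ⟪Φ y, crossMap (fderiv ℝ H y) y⟫) y := by
  have hT (v : ℝ³) : ContinuousAt (fun z ↦ fderiv ℝ H z v) y :=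
    ((hH.fderiv_right (m := 0) (by norm_num)).continuousAt).clm_apply continuousAt_const
  have hcr (u v : ℝ³) : ContinuousAt (fun z ↦ cross (fderiv ℝ H z u) (fderiv ℝ H z v)) y :=
    (crossCLM.continuous.continuousAt.comp (hT u)).clm_apply (hT v)
  have hp (i : Fin 3) : ContinuousAt (fun z : ℝ³ ↦ z i) y := by fun_prop
  have hcm : ContinuousAt (fun z ↦ crossMap (fderiv ℝ H z) z) y :=
    (((hp 0).smul (hcr _ _)).add ((hp 1).smul (hcr _ _))).add ((hp 2).smul (hcr _ _))
  exact hΦ.inner hcm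

/-- An integral formula for deformations which preserve the area form to first order. -/
theorem integral_mul_inner_crossMap_eq_zero (hΦ : ∀ y ≠ 0, ContDiffAt ℝ 1 Φ y)
    (hH : ∀ y ≠ 0, ContDiffAt ℝ 2 H y)
    (h : ∀ y ≠ 0, ∀ u v,
      cross (fderiv ℝ H y u) (fderiv ℝ Φ y v) + cross (fderiv ℝ Φ y u) (fderiv ℝ H y v) = 0)
    (hg : ContDiff ℝ 1 g) (hgd : ∀ y, HasFDerivAt g (c y • innerSL ℝ y) y)
    (hgc : HasCompactSupport g) (hg0 : g =ᶠ[nhds 0] 0) :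
    ∫ y, g y * ⟪Φ y, crossMap (fderiv ℝ H y) y⟫ = 0 := by
  set b : Fin 3 → ℝ³ → ℝ := fun i z ↦
    ⟪cross (Φ z) (H z), fderiv ℝ H z (EuclideanSpace.single i 1)⟫ with hb
  have hbd (i : Fin 3) {y : ℝ³} (hy : y ≠ 0) : ContDiffAt ℝ 1 (b i) y :=
    ((hΦ y hy).cross ((hH y hy).of_le (by norm_num))).inner ℝ
      (((hH y hy).fderiv_right (m := 1) (by norm_num)).clm_apply contDiffAt_const)
  have hV (i j : Fin 3) : ContDiff ℝ 1 fun z ↦ g z * (z i * b j z - z j * b i z) := by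
    rw [contDiff_iff_contDiffAt]
    intro y
    rcases eq_or_ne y 0 with rfl | hy
    · refine (contDiffAt_const (c := (0 : ℝ))).congr_of_eventuallyEq ?_
      filter_upwards [hg0] with z hz
      simp [hz]
    · have hp (i : Fin 3) : ContDiffAt ℝ 1 (fun z : ℝ³ ↦ z i) y :=
        (EuclideanSpace.proj (𝕜 := ℝ) i).contDiff.contDiffAt
      exact hg.contDiffAt.mul (((hp i).mul (hbd j hy)).sub ((hp j).mul (hbd i hy)))
  have hVc (i j : Fin 3) : HasCompactSupport fun z ↦ g z * (z i * b j z - z j * b i z) :=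
    hgc.mul_right
  have hVi (i j : Fin 3) (v : ℝ³) : MeasureTheory.Integrable
      fun y ↦ fderiv ℝ (fun z ↦ g z * (z i * b j z - z j * b i z)) y v :=
    (((hV i j).continuous_fderiv (by simp)).clm_apply
      continuous_const).integrable_of_hasCompactSupport ((hVc i j).fderiv_apply ℝ v)
  have hV0 (i j : Fin 3) (v : ℝ³) :
      ∫ y, fderiv ℝ (fun z ↦ g z * (z i * b j z - z j * b i z)) y v = 0 :=
    integral_fderiv_eq_zero (hV i j) (hVc i j) v
  have hdiv (y : ℝ³) : g y * ⟪Φ y, crossMap (fderiv ℝ H y) y⟫ = -2⁻¹ *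
      (fderiv ℝ (fun z ↦ g z * (z 1 * b 2 z - z 2 * b 1 z)) y (EuclideanSpace.single 0 1) +
        fderiv ℝ (fun z ↦ g z * (z 2 * b 0 z - z 0 * b 2 z)) y (EuclideanSpace.single 1 1) +
        fderiv ℝ (fun z ↦ g z * (z 0 * b 1 z - z 1 * b 0 z)) y (EuclideanSpace.single 2 1)) := by
    rcases eq_or_ne y 0 with rfl | hy
    · have hz (i j : Fin 3) (v : ℝ³) :
          fderiv ℝ (fun z ↦ g z * (z i * b j z - z j * b i z)) 0 v = 0 := by
        have h0 : (fun z ↦ g z * (z i * b j z - z j * b i z)) =ᶠ[nhds 0] fun _ ↦ 0 := by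
          filter_upwards [hg0] with z hz
          simp [hz]
        rw [h0.fderiv_eq]
        simp
      simp [hz, hg0.eq_of_nhds]
    · rw [divergence_smul_cross_self (hgd y) fun i ↦ (hbd i hy).differentiableAt (by simp)]
      have hcurl (i j : Fin 3) := fderiv_inner_cross_sub ((hΦ y hy).differentiableAt (by simp))
        (hH y hy) (h y hy (EuclideanSpace.single i 1) (EuclideanSpace.single j 1))
      rw [hb, hcurl, hcurl, hcurl, crossMap]
      simp only [inner_add_right, real_inner_smul_right]
      ring
  simp only [hdiv]
  have hadd := MeasureTheory.integral_add ((hVi 1 2 (EuclideanSpace.single 0 1)).add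
    (hVi 2 0 (EuclideanSpace.single 1 1))) (hVi 0 1 (EuclideanSpace.single 2 1))
  rw [MeasureTheory.integral_add' (hVi _ _ _) (hVi _ _ _), hV0, hV0, hV0] at hadd
  simp only [Pi.add_apply] at hadd
  rw [MeasureTheory.integral_const_mul, hadd]
  simp

end Integral

/-! ### Rigidity -/

/-- A smooth radial cutoff function, equal to `1` at a given point and supported away from `0`. -/
lemma exists_radial_cutoff {x : ℝ³} (hx : x ≠ 0) :
    ∃ g c : ℝ³ → ℝ, ContDiff ℝ 1 g ∧ (∀ y, HasFDerivAt g (c y • innerSL ℝ y) y) ∧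
      HasCompactSupport g ∧ g =ᶠ[nhds 0] 0 ∧ (∀ y, 0 ≤ g y) ∧ g x = 1 := by
  have hr : 0 < ‖x‖ ^ 2 := by positivity
  let b : ContDiffBump (‖x‖ ^ 2) := ⟨‖x‖ ^ 2 / 4, ‖x‖ ^ 2 / 2, by linarith, by linarith⟩
  have hb : ContDiff ℝ 1 b := b.contDiff
  refine ⟨fun y ↦ b (‖y‖ ^ 2), fun y ↦ deriv b (‖y‖ ^ 2) * 2, hb.comp (contDiff_norm_sq ℝ), ?_, ?_,
    ?_, fun y ↦ b.nonneg, b.one_of_mem_closedBall (mem_closedBall_self b.rIn_pos.le)⟩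
  · intro y
    rw [mul_smul, ofNat_smul_eq_nsmul]
    exact (hb.differentiable (by simp) _).hasDerivAt.comp_hasFDerivAt y
      (hasStrictFDerivAt_norm_sq y).hasFDerivAt
  · refine HasCompactSupport.intro (isCompact_closedBall 0 (2 * ‖x‖)) fun y hy ↦ ?_
    refine b.zero_of_le_dist ?_
    rw [mem_closedBall_zero_iff, not_le] at hy
    refine le_trans ?_ (le_abs_self _)
    change ‖x‖ ^ 2 / 2 ≤ ‖y‖ ^ 2 - ‖x‖ ^ 2
    nlinarith [norm_nonneg x]
  · have h0 : ∀ᶠ y : ℝ³ in nhds 0, ‖y‖ ^ 2 < ‖x‖ ^ 2 / 2 :=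
      (continuous_norm.pow 2).continuousAt.eventually_lt continuousAt_const (by simpa using hr)
    filter_upwards [h0] with y hy
    refine b.zero_of_le_dist ?_
    refine le_trans ?_ (neg_le_abs _)
    change ‖x‖ ^ 2 / 2 ≤ -(‖y‖ ^ 2 - ‖x‖ ^ 2)
    linarith

lemma mul_pos_of_isPreconnected {X : Type*} [TopologicalSpace X] {s : Set X}
    (hs : IsPreconnected s) {f : X → ℝ} (hf : ContinuousOn f s) (h0 : ∀ x ∈ s, f x ≠ 0) {x y : X}
    (hx : x ∈ s) (hy : y ∈ s) : 0 < f x * f y := by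
  by_contra! h
  have key {a b : X} (ha : a ∈ s) (hb : b ∈ s) (ha' : f a ≤ 0) (hb' : 0 ≤ f b) : False := by
    obtain ⟨z, hz, hz0⟩ := hs.intermediate_value ha hb hf ⟨ha', hb'⟩
    exact h0 z hz hz0
  rcases mul_nonpos_iff.1 h with ⟨h₁, h₂⟩ | ⟨h₁, h₂⟩
  exacts [key hy hx h₂ h₁, key hx hy h₁ h₂]

lemma isConnected_compl_zero : IsConnected ({0}ᶜ : Set ℝ³) :=
  isConnected_compl_singleton_of_one_lt_rank one_lt_rank_euclideanSpace 0

section Rigidity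

variable {φ ν η : 𝕊² → ℝ³} (hφ : Smooth3 φ) (hν : IsUnitNormalField φ ν)
  (hK : PosGaussCurvature φ ν)

include hφ hν hK in
/-- The support function of a strictly convex surface with respect to an interior point. -/
lemma PosGaussCurvature.inner_crossMap_ne_zero {p : ℝ³} (hp : ∀ x, ⟪φ x - p, ν x⟫ ≠ 0) {y : ℝ³}
    (hy : y ≠ 0) : ⟪radialExt φ y - p, crossMap (fderiv ℝ (radialExt φ) y) y⟫ ≠ 0 := by
  obtain ⟨u, v, huv⟩ := exists_cross_eq_self y
  have hpos := hK.inner_cross_fderiv_pos hφ hν huv hy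
  have hne : cross (fderiv ℝ (radialExt φ) y u) (fderiv ℝ (radialExt φ) y v) ≠ 0 := by
    intro h
    rw [h, inner_zero_right] at hpos
    exact hpos.false
  have h := eq_smul_cross_of_inner_eq_zero hne (hν.inner_fderiv hφ hy u) (hν.inner_fderiv hφ hy v)
  nth_rw 3 [← huv]
  rw [crossMap_cross]
  intro h0
  have hp' : ⟪radialExt φ y - p, radialExt ν y⟫ ≠ 0 := hp (toSphere y)
  rw [h, inner_smul_right, h0, mul_zero] at hp'
  exact hp' rfl

include hφ hν hK in
theorem IsIsogaussDeformation.fderiv_eq_zero (hη : IsIsogaussDeformation φ ν η) {y : ℝ³}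
    (hy : y ≠ 0) : fderiv ℝ (radialExt η) y = 0 := by
  obtain ⟨p, hp⟩ := hK.exists_inner_sub_ne_zero hφ hν
  obtain ⟨g, c, hg, hgd, hgc, hg0, hgnn, hgy⟩ := exists_radial_cutoff hy
  have hone : (1 : WithTop ℕ∞) ≤ 2 := by norm_num
  have hΦ (z : ℝ³) (hz : z ≠ 0) : ContDiffAt ℝ 1 (radialExt φ) z :=
    (hφ.contDiffAt_two_radialExt hz).of_le hone
  have hΦp (z : ℝ³) (hz : z ≠ 0) : ContDiffAt ℝ 1 (fun z ↦ radialExt φ z - p) z :=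
    (hΦ z hz).sub contDiffAt_const
  have hH (z : ℝ³) (hz : z ≠ 0) : ContDiffAt ℝ 2 (radialExt η) z :=
    hη.1.contDiffAt_two_radialExt hz
  set Q : ℝ³ → ℝ := fun z ↦ ⟪radialExt φ z - p, crossMap (fderiv ℝ (radialExt φ) z) z⟫ with hQ
  set J : ℝ³ → ℝ := fun z ↦ ⟪radialExt φ z - p, crossMap (fderiv ℝ (radialExt η) z) z⟫ with hJ
  have hQpos {z : ℝ³} (hz : z ≠ 0) : 0 < Q z * Q y := by
    refine mul_pos_of_isPreconnected isConnected_compl_zero.isPreconnected (fun z hz ↦ ?_)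
      (fun z hz ↦ hK.inner_crossMap_ne_zero hφ hν hp hz) hz hy
    exact (continuousAt_inner_crossMap (hΦp z hz).continuousAt (hΦ z hz)).continuousWithinAt
  have hJQ {u v z : ℝ³} (huv : cross u v = z) (hz : z ≠ 0) : ∃ κ : ℝ, 0 ≤ κ ∧ J z = -κ * Q z ∧
      (κ = 0 → fderiv ℝ (radialExt η) z u = 0 ∧ fderiv ℝ (radialExt η) z v = 0) := by
    obtain ⟨κ, hκ, hκQ, hκ0⟩ := hη.exists_cross_fderiv_eq hφ hν hK huv hz
    refine ⟨κ, hκ, ?_, hκ0⟩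
    rw [← crossMap_cross, ← crossMap_cross, huv] at hκQ
    simp only [hJ, hQ]
    rw [hκQ, inner_smul_right]
  have hgJ : ∫ z, g z * J z = 0 := by
    refine integral_mul_inner_crossMap_eq_zero hΦp hH (fun z hz u v ↦ ?_) hg hgd hgc hg0
    rw [fderiv_sub_const]
    exact hη.cross_fderiv hφ hz u v
  have hcont : Continuous fun z ↦ g z * J z := by
    rw [continuous_iff_continuousAt]
    intro z
    rcases eq_or_ne z 0 with rfl | hz
    · refine (continuousAt_const (y := (0 : ℝ))).congr ?_
      filter_upwards [hg0] with z hz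
      simp [hz]
    · exact hg.continuous.continuousAt.mul (continuousAt_inner_crossMap (hΦp z hz).continuousAt
        ((hH z hz).of_le hone))
  have hnonneg (z : ℝ³) : 0 ≤ g z * J z * -Q y := by
    rcases eq_or_ne z 0 with rfl | hz
    · simp [hg0.eq_of_nhds]
    · obtain ⟨u, v, huv⟩ := exists_cross_eq_self z
      obtain ⟨κ, hκ, hκQ, -⟩ := hJQ huv hz
      have := mul_nonneg (mul_nonneg (hgnn z) hκ) (hQpos hz).le
      rw [hκQ]
      linarith
  have hJy : J y = 0 := by
    by_contra hJy
    have hQy : Q y ≠ 0 := hK.inner_crossMap_ne_zero hφ hν hp hy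
    have h : 0 < ∫ z, g z * J z * -Q y :=
      (hcont.mul continuous_const).integral_pos_of_hasCompactSupport_nonneg_nonzero
        hgc.mul_right.mul_right hnonneg (x := y) (by simp [hgy, hJy, hQy])
    rw [MeasureTheory.integral_mul_const, hgJ, zero_mul] at h
    exact h.false
  ext1 w
  obtain ⟨t, w, rfl, hw⟩ := exists_smul_add_orthogonal hy w
  rw [map_add, map_smul, hη.1.fderiv_radialExt_self hy]
  rcases eq_or_ne w 0 with rfl | hw0
  · simp
  obtain ⟨v, hv⟩ := exists_cross_eq hw0 hw
  obtain ⟨κ, -, hκQ, hκ0⟩ := hJQ hv hy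
  rw [hJy, zero_eq_mul, neg_eq_zero] at hκQ
  simp [(hκ0 (hκQ.resolve_right (hK.inner_crossMap_ne_zero hφ hν hp hy))).1]

end Rigidity

/-- **Gauss infinitesimal rigidity of strictly convex surfaces.** -/
theorem gauss_infinitesimal_rigidity (φ ν η : 𝕊² → ℝ³)
    (hφ : Smooth3 φ) (hφinj : Function.Injective φ)
    (hφimm : ∀ x : 𝕊², Function.Injective (mfd φ x))
    (hν : IsUnitNormalField φ ν)
    (hK : PosGaussCurvature φ ν)
    (hη : IsIsogaussDeformation φ ν η) :
    ∃ a : ℝ³, ∀ x : 𝕊², η x = a := by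
  obtain ⟨a, ha⟩ := isOpen_compl_singleton.exists_is_const_of_fderiv_eq_zero
    isConnected_compl_zero.isPreconnected
    (fun y hy ↦ ((hη.1.contDiffAt_radialExt hy).differentiableAt
      (by simp)).differentiableWithinAt)
    (fun y hy ↦ hη.fderiv_eq_zero hφ hν hK hy)
  refine ⟨a, fun x ↦ ?_⟩
  rw [← ha x (ne_zero_of_mem_unit_sphere x), radialExt, toSphere_coe]
end
end

section
/- Let φ : 𝕊² → ℝ³ be a smooth immersion, ν a unit normal field for φ, and η an isogauss infinitesimal deformation of φ with respect to ν. Let x ∈ 𝕊² be a point at which the positive Gauss curvature condition holds, i.e. ⟨dν_x X × dν_x Y, dφ_x X × dφ_x Y⟩ > 0 for all linearly independent X, Y ∈ T_x𝕊². Then (1) ⟨dη_x X × dη_x Y, dφ_x X × dφ_x Y⟩ ≤ 0 for all X, Y ∈ T_x𝕊², and (2) if dη_x ≠ 0, then ⟨dη_x X × dη_x Y, dφ_x X × dφ_x Y⟩ < 0 for all linearly independent X, Y ∈ T_x𝕊². (Writing dη_x = L ∘ dφ_x, these inner products equal det L · ‖dφ_x X × dφ_x Y‖², so the statement says det(dη)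 ≤ 0 with equality only if dη = 0.) -/
noncomputable section

open scoped Manifold RealInnerProductSpace
open Metric Module

local notation "ℝ³" => EuclideanSpace ℝ (Fin 3)

local notation "𝕊²" => sphere (0 : ℝ³) 1

lemma cross_add_left (a b c : ℝ³) : cross (a + b) c = cross a c + cross b c := by
  simp [cross]

lemma cross_add_right (a b c : ℝ³) : cross a (b + c) = cross a b + cross a c := by
  simp [cross]

lemma cross_smul_left (t : ℝ) (a b : ℝ³) : cross (t • a) b = t • cross a b := by
  simp [cross]

lemma cross_smul_right_s2 (t : ℝ) (a b : ℝ³) : cross a (t • b) = t • cross a b := by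
  simp [cross]

lemma cross_self_eq_zero (a : ℝ³) : cross a a = 0 := by
  simp [cross]

lemma cross_swap (a b : ℝ³) : cross a b = -cross b a := by
  ext i
  fin_cases i <;> simp [cross, crossProduct] <;> ring

/-- If a linear map has vanishing trace and is symmetric with respect to a definite symmetric form,
its determinant is negative unless it vanishes. -/
lemma sq_add_mul_pos {p q r h₁ h₂ h₃ : ℝ} (hdet : 0 < h₁ * h₃ - h₂ * h₂)
    (hsymm : p * h₂ + q * h₃ = r * h₁ - p * h₂) (hne : ¬(p = 0 ∧ q = 0 ∧ r = 0)) :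
    0 < p ^ 2 + q * r := by
  have h₁ne : h₁ ≠ 0 := by
    rintro rfl
    nlinarith [sq_nonneg h₂]
  have hsq : 0 < h₁ ^ 2 := by positivity
  have key : h₁ ^ 2 * (p ^ 2 + q * r) = (h₁ * p + h₂ * q) ^ 2 + (h₁ * h₃ - h₂ * h₂) * q ^ 2 := by
    linear_combination (-(q * h₁)) * hsymm
  refine pos_of_mul_pos_right (b := p ^ 2 + q * r) (a := h₁ ^ 2) ?_ hsq.le
  rw [key]
  by_cases hq : q = 0
  · subst hq
    have hp : p ≠ 0 := by
      rintro rfl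
      exact hne ⟨rfl, rfl, by simpa [h₁ne] using hsymm.symm⟩
    simp only [mul_zero, add_zero]
    positivity
  · have : 0 < (h₁ * h₃ - h₂ * h₂) * q ^ 2 := by positivity
    positivity

/-- Two independent vectors orthogonal to a nonzero vector of `ℝ³` span its orthogonal
complement. -/
lemma exists_eq_smul_add_smul_s2 {n f₁ f₂ a : ℝ³} (hn : n ≠ 0) (hf : LinearIndependent ℝ ![f₁, f₂])
    (h₁ : ⟪n, f₁⟫ = 0) (h₂ : ⟪n, f₂⟫ = 0) (ha : ⟪n, a⟫ = 0) :
    ∃ p q : ℝ, p • f₁ + q • f₂ = a := by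
  have hle : Submodule.span ℝ (Set.range ![f₁, f₂]) ≤ (ℝ ∙ n)ᗮ := by
    rw [Submodule.span_le]
    rintro _ ⟨i, rfl⟩
    fin_cases i
    · exact Submodule.mem_orthogonal_singleton_iff_inner_right.2 h₁
    · exact Submodule.mem_orthogonal_singleton_iff_inner_right.2 h₂
  have heq := Submodule.eq_of_le_of_finrank_eq hle (by
    rw [finrank_span_eq_card hf, Submodule.finrank_orthogonal_span_singleton (n := 2) hn]
    simp)
  have : a ∈ Submodule.span ℝ (Set.range ![f₁, f₂]) :=
    heq ▸ Submodule.mem_orthogonal_singleton_iff_inner_right.2 ha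
  rw [Matrix.range_cons, Matrix.range_cons, Matrix.range_empty, Set.union_empty,
    Set.singleton_union] at this
  exact Submodule.mem_span_pair.1 this

/-- If a normal field annihilates the derivative of `g`, then the derivatives of `g` and of the
normal field pair symmetrically. -/
lemma inner_fderiv_comm {E F : Type*} [NormedAddCommGroup E] [NormedSpace ℝ E]
    [NormedAddCommGroup F] [InnerProductSpace ℝ F] {g n : E → F} {u : E}
    (hg : ContDiffAt ℝ 2 g u) (hn : DifferentiableAt ℝ n u)
    (h : ∀ᶠ v in nhds u, ∀ X, ⟪fderiv ℝ g v X, n v⟫ = 0) (X Y : E) :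
    ⟪fderiv ℝ g u X, fderiv ℝ n u Y⟫ = ⟪fderiv ℝ g u Y, fderiv ℝ n u X⟫ := by
  have hsymm : IsSymmSndFDerivAt ℝ g u := hg.isSymmSndFDerivAt (by simp)
  have hd : DifferentiableAt ℝ (fderiv ℝ g) u :=
    (hg.fderiv_right (m := 1) (by norm_num)).differentiableAt (by simp)
  have key (X Y : E) :
      ⟪fderiv ℝ g u X, fderiv ℝ n u Y⟫ + ⟪fderiv ℝ (fderiv ℝ g) u Y X, n u⟫ = 0 := by
    have h₁ : HasFDerivAt (fun v ↦ fderiv ℝ g v X) ((fderiv ℝ (fderiv ℝ g) u).flip X) u := by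
      simpa using hd.hasFDerivAt.clm_apply (hasFDerivAt_const X u)
    have h₂ := h₁.inner ℝ hn.hasFDerivAt
    have h₃ : (fun v ↦ ⟪fderiv ℝ g v X, n v⟫) =ᶠ[nhds u] fun _ ↦ (0 : ℝ) :=
      h.mono fun v hv ↦ hv X
    have h₄ := h₂.unique ((hasFDerivAt_const (0 : ℝ) u).congr_of_eventuallyEq h₃)
    simpa using DFunLike.congr_fun h₄ Y
  have := key X Y
  have := key Y X
  rw [hsymm X Y] at this
  linarith

lemma mfd_eq_fderiv {f : 𝕊² → ℝ³} (hf : Smooth3 f) (x : 𝕊²) :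
    mfd f x = fderiv ℝ (f ∘ (extChartAt (𝓡 2) x).symm) (extChartAt (𝓡 2) x x) := by
  have h : MDifferentiableAt (𝓡 2) 𝓘(ℝ, ℝ³) f x := (hf x).mdifferentiableAt (by simp)
  rw [mfd, h.mfderiv]
  simp only [ModelWithCorners.range_eq_univ, fderivWithin_univ, writtenInExtChartAt]
  rfl

lemma contDiffAt_comp_extChartAt_symm {f : 𝕊² → ℝ³} (hf : Smooth3 f) (x : 𝕊²) :
    ContDiffAt ℝ (⊤ : ℕ∞) (f ∘ (extChartAt (𝓡 2) x).symm) (extChartAt (𝓡 2) x x) := by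
  have := (contMDiffAt_iff.1 (hf x)).2
  rwa [ModelWithCorners.range_eq_univ, contDiffWithinAt_univ] at this

/-- A vector field `f` whose derivative is orthogonal to `ν` satisfies
`⟨df X, dν Y⟩ = ⟨df Y, dν X⟩`. -/
lemma inner_mfd_comm {f ν : 𝕊² → ℝ³} (hf : Smooth3 f) (hν : Smooth3 ν)
    (h : ∀ (x : 𝕊²) (X : TangentSpace (𝓡 2) x), ⟪mfd f x X, ν x⟫ = 0) (x : 𝕊²)
    (X Y : TangentSpace (𝓡 2) x) :
    ⟪mfd f x X, mfd ν x Y⟫ = ⟪mfd f x Y, mfd ν x X⟫ := by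
  rw [mfd_eq_fderiv hf, mfd_eq_fderiv hν]
  refine inner_fderiv_comm
    ((contDiffAt_comp_extChartAt_symm hf x).of_le (WithTop.coe_le_coe.2 le_top))
    ((contDiffAt_comp_extChartAt_symm hν x).differentiableAt (by simp)) ?_ X Y
  filter_upwards [extChartAt_target_mem_nhds (I := 𝓡 2) x] with v hv X
  have hs : MDifferentiableAt 𝓘(ℝ, EuclideanSpace ℝ (Fin 2)) (𝓡 2) (extChartAt (𝓡 2) x).symm v := by
    have := mdifferentiableWithinAt_extChartAt_symm hv
    rwa [ModelWithCorners.range_eq_univ, mdifferentiableWithinAt_univ] at this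
  have hfd : MDifferentiableAt (𝓡 2) 𝓘(ℝ, ℝ³) f ((extChartAt (𝓡 2) x).symm v) :=
    (hf _).mdifferentiableAt (by simp)
  have hcomp := mfderiv_comp v hfd hs
  rw [mfderiv_eq_fderiv] at hcomp
  rw [hcomp]
  exact h _ _

/-- At a point of positive Gauss curvature, the "determinant" of the differential of an
isogauss infinitesimal deformation is nonpositive, and negative unless the differential
vanishes. -/
theorem det_deta_nonpos (φ ν η : 𝕊² → ℝ³)
    (hφ : Smooth3 φ) (hφimm : ∀ x : 𝕊², Function.Injective (mfd φ x))
    (hν : IsUnitNormalField φ ν)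
    (hη : IsIsogaussDeformation φ ν η)
    (x : 𝕊²)
    (hKx : ∀ X Y : TangentSpace (𝓡 2) x, LinearIndependent ℝ ![X, Y] →
      0 < ⟪cross (mfd ν x X) (mfd ν x Y), cross (mfd φ x X) (mfd φ x Y)⟫) :
    (∀ X Y : TangentSpace (𝓡 2) x,
        ⟪cross (mfd η x X) (mfd η x Y), cross (mfd φ x X) (mfd φ x Y)⟫ ≤ 0) ∧
      (mfd η x ≠ 0 → ∀ X Y : TangentSpace (𝓡 2) x, LinearIndependent ℝ ![X, Y] →
        ⟪cross (mfd η x X) (mfd η x Y), cross (mfd φ x X) (mfd φ x Y)⟫ < 0) := by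
  have hηs := inner_mfd_comm hη.1 hν.1 hη.2.1 x
  have hφs := inner_mfd_comm hφ hν.1 (fun y X ↦ by rw [real_inner_comm]; exact hν.2.2 y X) x
  have hνx : ν x ≠ 0 := by
    intro h
    simpa [h] using hν.2.1 x
  have main (X Y : TangentSpace (𝓡 2) x) (hXY : LinearIndependent ℝ ![X, Y])
      (hne : ¬(mfd η x X = 0 ∧ mfd η x Y = 0)) :
      ⟪cross (mfd η x X) (mfd η x Y), cross (mfd φ x X) (mfd φ x Y)⟫ < 0 := by
    have hK := hKx X Y hXY
    have hf : LinearIndependent ℝ ![mfd φ x X, mfd φ x Y] := by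
      rw [LinearIndependent.pair_iff] at hXY ⊢
      intro s t hst
      refine hXY s t (hφimm x ?_)
      rw [map_add, map_smul, map_smul, hst, map_zero]
    have hC := hη.2.2 x X Y
    have hsη := hηs X Y
    have hsφ := hφs X Y
    have span (Z : TangentSpace (𝓡 2) x) :=
      exists_eq_smul_add_smul_s2 hνx hf (hν.2.2 x X) (hν.2.2 x Y)
        ((real_inner_comm _ _).trans (hη.2.1 x Z))
    obtain ⟨p, q, ha⟩ := span X
    obtain ⟨r, s, hb⟩ := span Y
    rw [← ha, ← hb] at hC hsη hne ⊢
    generalize mfd φ x X = f₁ at *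
    generalize mfd φ x Y = f₂ at *
    generalize mfd ν x X = n₁ at *
    generalize mfd ν x Y = n₂ at *
    have hF : cross f₁ f₂ ≠ 0 := by
      intro h
      simp [h] at hK
    simp only [cross_add_left, cross_add_right, cross_smul_left, cross_smul_right_s2,
      cross_self_eq_zero, smul_zero, zero_add, add_zero, ← add_smul, smul_eq_zero, hF,
      or_false] at hC
    obtain rfl : s = -p := by linarith
    rw [inner_cross_cross, real_inner_comm f₁ n₁, real_inner_comm f₂ n₂,
      real_inner_comm f₂ n₁, real_inner_comm f₁ n₂, ← hsφ] at hK
    simp only [inner_add_left, inner_smul_left, conj_trivial, ← hsφ] at hsη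
    have hpos : 0 < p ^ 2 + q * r := by
      refine sq_add_mul_pos hK (by linarith) ?_
      rintro ⟨rfl, rfl, rfl⟩
      simp at hne
    have hdet : cross (p • f₁ + q • f₂) (r • f₁ + -p • f₂) = (-(p ^ 2 + q * r)) • cross f₁ f₂ := by
      simp only [cross_add_left, cross_add_right, cross_smul_left, cross_smul_right_s2,
        cross_self_eq_zero, cross_swap f₂ f₁]
      module
    rw [hdet, inner_smul_left, conj_trivial]
    have := real_inner_self_pos.2 hF
    nlinarith
  refine ⟨fun X Y ↦ ?_, fun hne X Y hXY ↦ main X Y hXY ?_⟩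
  · by_cases hXY : LinearIndependent ℝ ![X, Y]
    · by_cases h : mfd η x X = 0 ∧ mfd η x Y = 0
      · rw [h.1, h.2, cross_self_eq_zero, inner_zero_left]
      · exact (main X Y hXY h).le
    · suffices h : cross (mfd φ x X) (mfd φ x Y) = 0 by rw [h, inner_zero_right]
      rw [LinearIndependent.pair_iff] at hXY
      push Not at hXY
      obtain ⟨s, t, hst, hne⟩ := hXY
      have hst' : s • mfd φ x X + t • mfd φ x Y = 0 := by
        rw [← map_smul, ← map_smul, ← map_add, hst, map_zero]
      by_cases hs : s = 0
      · subst hs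
        have : mfd φ x Y = 0 := by simpa [hne rfl] using hst'
        rw [this]
        simp [cross]
      · have : mfd φ x X = (-(s⁻¹ * t)) • mfd φ x Y := by
          rw [neg_smul, mul_smul, eq_neg_iff_add_eq_zero, ← smul_right_injective _ hs |>.eq_iff]
          simpa [smul_smul, ← mul_assoc, hs] using hst'
        rw [this, cross_smul_left, cross_self_eq_zero, smul_zero]
  · rintro ⟨hX, hY⟩
    have : Fintype.card (Fin 2) = finrank ℝ (TangentSpace (𝓡 2) x) := by
      change _ = finrank ℝ (EuclideanSpace ℝ (Fin 2))
      simp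
    let b := basisOfLinearIndependentOfCardEqFinrank hXY this
    refine hne (ContinuousLinearMap.coe_injective (b.ext fun i ↦ ?_))
    fin_cases i
    · simpa [b] using hX
    · simpa [b] using hY
end
end

section
/- Let W ⊆ ℝ³ be a 2-dimensional linear subspace and f : W → ℝ³ a linear map satisfying ⟨f X, Y⟩ + ⟨X, f Y⟩ = 0 for all X, Y ∈ W. Then there exists a unique vector η ∈ ℝ³ such that f X = η × X for all X ∈ W. -/
noncomputable section

open scoped RealInnerProductSpace
open Module

local notation "ℝ³" => EuclideanSpace ℝ (Fin 3)

open scoped Matrix in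
/-- Expansion of a vector in the orthonormal frame `p`, `q`, `p ⨯₃ q`. -/
lemma eq_sum_dotProduct_smul_frame {p q : Fin 3 → ℝ} (hp : p ⬝ᵥ p = 1) (hq : q ⬝ᵥ q = 1)
    (hpq : p ⬝ᵥ q = 0) (v : Fin 3 → ℝ) :
    v = (v ⬝ᵥ p) • p + (v ⬝ᵥ q) • q + (v ⬝ᵥ (p ⨯₃ q)) • (p ⨯₃ q) := by
  have hqp : q ⬝ᵥ p = 0 := by rw [dotProduct_comm, hpq]
  have hn : (p ⨯₃ q) ⬝ᵥ (p ⨯₃ q) = 1 := by rw [cross_dot_cross, hp, hq, hpq, hqp]; ring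
  have h : (v ⨯₃ (p ⨯₃ q)) ⨯₃ (p ⨯₃ q) = -((v ⬝ᵥ p) • p + (v ⬝ᵥ q) • q) := by
    rw [cross_cross_eq_smul_sub_smul' v p q]
    simp only [map_sub, map_smul, LinearMap.sub_apply, LinearMap.smul_apply,
      cross_cross_eq_smul_sub_smul', hp, hq, hpq, dotProduct_comm p v]
    module
  rw [cross_cross_eq_smul_sub_smul, hn] at h
  linear_combination (norm := module) -h

open scoped Matrix in
lemma cross_frame_left {p q a : Fin 3 → ℝ} (hp : p ⬝ᵥ p = 1) (hq : q ⬝ᵥ q = 1)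
    (hpq : p ⬝ᵥ q = 0) (ha : a ⬝ᵥ p = 0) (c : ℝ) :
    (c • p - (a ⬝ᵥ (p ⨯₃ q)) • q + (a ⬝ᵥ q) • (p ⨯₃ q)) ⨯₃ p = a := by
  have hqp : q ⬝ᵥ p = 0 := by rw [dotProduct_comm, hpq]
  conv_rhs => rw [eq_sum_dotProduct_smul_frame hp hq hpq a, ha]
  simp only [map_add, map_sub, map_smul, LinearMap.add_apply, LinearMap.sub_apply,
    LinearMap.smul_apply, cross_self, cross_cross_eq_smul_sub_smul, hp, hqp, ← cross_anticomm p q]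
  module

open scoped Matrix in
/-- Prescribing `η ⨯₃ p` and `η ⨯₃ q` on an orthonormal pair, subject to skew-symmetry. -/
lemma exists_cross_eq_of_orthonormal {p q a b : Fin 3 → ℝ} (hp : p ⬝ᵥ p = 1)
    (hq : q ⬝ᵥ q = 1) (hpq : p ⬝ᵥ q = 0) (ha : a ⬝ᵥ p = 0) (hb : b ⬝ᵥ q = 0)
    (hab : a ⬝ᵥ q + b ⬝ᵥ p = 0) : ∃ η : Fin 3 → ℝ, η ⨯₃ p = a ∧ η ⨯₃ q = b := by
  have hqp : q ⬝ᵥ p = 0 := by rw [dotProduct_comm, hpq]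
  refine ⟨(b ⬝ᵥ (p ⨯₃ q)) • p - (a ⬝ᵥ (p ⨯₃ q)) • q + (a ⬝ᵥ q) • (p ⨯₃ q),
    cross_frame_left hp hq hpq ha _, ?_⟩
  have h := cross_frame_left hq hp hqp hb (-(a ⬝ᵥ (p ⨯₃ q)))
  rw [← cross_anticomm p q, dotProduct_neg, eq_neg_of_add_eq_zero_right hab] at h
  convert h using 3
  module

open scoped Matrix in
lemma eq_zero_of_cross_eq_zero {p q ζ : Fin 3 → ℝ} (hp : p ⬝ᵥ p = 1)
    (hq : q ⬝ᵥ q = 1) (hpq : p ⬝ᵥ q = 0) (h₁ : ζ ⨯₃ p = 0) (h₂ : ζ ⨯₃ q = 0) : ζ = 0 := by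
  have h₃ := cross_cross_eq_smul_sub_smul ζ p p
  have h₄ := cross_cross_eq_smul_sub_smul ζ q p
  rw [h₁, hp] at h₃
  rw [h₂, dotProduct_comm q p, hpq] at h₄
  have h₅ : (ζ ⬝ᵥ p) • q = 0 := by simpa using h₄.symm
  have h₆ : ζ ⬝ᵥ p = 0 := by simpa [hq] using congrArg (· ⬝ᵥ q) h₅
  simpa [h₆] using h₃.symm

lemma inner_eq_ofLp_dotProduct (x y : ℝ³) : ⟪x, y⟫ = x.ofLp ⬝ᵥ y.ofLp := by
  rw [EuclideanSpace.inner_eq_star_dotProduct, star_trivial, dotProduct_comm]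

open scoped Matrix in
lemma ofLp_cross (x y : ℝ³) : (cross x y).ofLp = x.ofLp ⨯₃ y.ofLp := rfl

/-- The linear map `X ↦ η × X`. -/
def crossLinearMap (η : ℝ³) : ℝ³ →ₗ[ℝ] ℝ³ where
  toFun := cross η
  map_add' x y := by ext1; simp [ofLp_cross]
  map_smul' c x := by ext1; simp [ofLp_cross]

/-- A linear map defined on a plane `W ⊆ ℝ³` whose symmetrized pairing vanishes is given,
in a unique way, by the cross product with a fixed vector `η ∈ ℝ³`. -/
theorem skew_map_on_plane_eq_cross (W : Submodule ℝ ℝ³) (hW : finrank ℝ W = 2)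
    (f : W →ₗ[ℝ] ℝ³)
    (hf : ∀ X Y : W, ⟪f X, (Y : ℝ³)⟫ + ⟪(X : ℝ³), f Y⟫ = 0) :
    ∃! η : ℝ³, ∀ X : W, f X = cross η (X : ℝ³) := by
  let e := (stdOrthonormalBasis ℝ W).reindex (finCongr hW)
  have he (i j : Fin 2) :
      (e i : ℝ³).ofLp ⬝ᵥ (e j : ℝ³).ofLp = if i = j then 1 else 0 := by
    rw [← inner_eq_ofLp_dotProduct, ← Submodule.coe_inner]
    exact orthonormal_iff_ite.mp e.orthonormal i j
  have hskew (i j : Fin 2) :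
      (f (e i)).ofLp ⬝ᵥ (e j : ℝ³).ofLp + (f (e j)).ofLp ⬝ᵥ (e i : ℝ³).ofLp = 0 := by
    have h := hf (e i) (e j)
    rwa [real_inner_comm (f (e j)) (e i : ℝ³), inner_eq_ofLp_dotProduct,
      inner_eq_ofLp_dotProduct] at h
  have hp : (e 0 : ℝ³).ofLp ⬝ᵥ (e 0 : ℝ³).ofLp = 1 := by simpa using he 0 0
  have hq : (e 1 : ℝ³).ofLp ⬝ᵥ (e 1 : ℝ³).ofLp = 1 := by simpa using he 1 1
  have hpq : (e 0 : ℝ³).ofLp ⬝ᵥ (e 1 : ℝ³).ofLp = 0 := by simpa using he 0 1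
  obtain ⟨η, h₀, h₁⟩ := exists_cross_eq_of_orthonormal hp hq hpq
    (self_eq_neg.mp (eq_neg_of_add_eq_zero_left (hskew 0 0)))
    (self_eq_neg.mp (eq_neg_of_add_eq_zero_left (hskew 1 1))) (hskew 0 1)
  refine ⟨WithLp.toLp 2 η, fun X ↦ ?_, fun ξ hξ ↦ ?_⟩
  · have h : f = crossLinearMap (WithLp.toLp 2 η) ∘ₗ W.subtype := by
      refine e.toBasis.ext fun i ↦ ?_
      rw [e.coe_toBasis]
      apply WithLp.ofLp_injective
      fin_cases i
      · exact h₀.symm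
      · exact h₁.symm
    exact LinearMap.congr_fun h X
  · have hz (i : Fin 2) := (congrArg WithLp.ofLp (hξ (e i))).symm
    apply WithLp.ofLp_injective
    refine sub_eq_zero.mp (eq_zero_of_cross_eq_zero hp hq hpq ?_ ?_)
    · rw [map_sub, LinearMap.sub_apply, sub_eq_zero]
      exact (hz 0).trans h₀.symm
    · rw [map_sub, LinearMap.sub_apply, sub_eq_zero]
      exact (hz 1).trans h₁.symm
end
end
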